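/- arXiv:1401.7096 — 2 statements merged into one kernel-verified Lean document; each statement's English description precedes it below -/
import Mathlib

section
/- Let G be the subgroup of GL(3,ℂ) generated by the three matrices σ₁ = diag(1, 1, ω), σ₃ = diag(1, ω, 1), and σ₂ whose entries are σ₂[i][i] = 1/2 + (√3/6)i on the diagonal and σ₂[i][j] = −1/2 + (√3/6)i off the diagonal (i ≠ j). Then G is a finite group of order 648, its center consists exactly of the three scalar matrices I, ωI, ω²I, and the quotient of G by its center has order 216. -/
open Matrix Complex

noncomputable section

/-- ω = e^{2πi/3}, a primitive third root of unity. -/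
def ω : ℂ := Complex.exp (2 * Real.pi * Complex.I / 3)

/-- The braiding gate σ₁ of the qutrit W-model. -/
def m1 : Matrix (Fin 3) (Fin 3) ℂ := diagonal ![1, 1, ω]

/-- The braiding gate σ₃ of the qutrit W-model. -/
def m3 : Matrix (Fin 3) (Fin 3) ℂ := diagonal ![1, ω, 1]

/-- The braiding gate σ₂ of the qutrit W-model:
diagonal entries 1/2 + (√3/6)i, off-diagonal entries −1/2 + (√3/6)i. -/
def m2 : Matrix (Fin 3) (Fin 3) ℂ :=
  Matrix.of fun i j =>
    if i = j then (1 / 2 : ℂ) + (Real.sqrt 3 / 6 : ℝ) * Complex.I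
    else -(1 / 2 : ℂ) + (Real.sqrt 3 / 6 : ℝ) * Complex.I


/-- Eisenstein integers `x + y ω` as a computable ring. -/
abbrev Eis := QuadraticAlgebra ℤ (-1) (-1)

/-- `θ = 1 + 2ω = √-3`. -/
def th : Eis := ⟨1, 2⟩

/-- powers of ω -/
def pw : Fin 3 → Eis := ![⟨1, 0⟩, ⟨0, 1⟩, ⟨-1, -1⟩]

/-- diagonal matrix of powers of ω -/
def dg (d : Fin 3 → Fin 3) : Matrix (Fin 3) (Fin 3) Eis := diagonal fun k => pw (d k)

/-- θ times the generators -/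
def gn : Fin 3 → Matrix (Fin 3) (Fin 3) Eis :=
  ![!![⟨1, 2⟩, ⟨0, 0⟩, ⟨0, 0⟩; ⟨0, 0⟩, ⟨1, 2⟩, ⟨0, 0⟩; ⟨0, 0⟩, ⟨0, 0⟩, ⟨-2, -1⟩],
    !![⟨0, 1⟩, ⟨-1, -1⟩, ⟨-1, -1⟩; ⟨-1, -1⟩, ⟨0, 1⟩, ⟨-1, -1⟩; ⟨-1, -1⟩, ⟨-1, -1⟩, ⟨0, 1⟩],
    !![⟨1, 2⟩, ⟨0, 0⟩, ⟨0, 0⟩; ⟨0, 0⟩, ⟨-2, -1⟩, ⟨0, 0⟩; ⟨0, 0⟩, ⟨0, 0⟩, ⟨1, 2⟩]]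

/-- θ times representatives of the left cosets of the diagonal subgroup -/
def rp : Fin 24 → Matrix (Fin 3) (Fin 3) Eis :=
  ![!![⟨1, 2⟩, ⟨0, 0⟩, ⟨0, 0⟩; ⟨0, 0⟩, ⟨1, 2⟩, ⟨0, 0⟩; ⟨0, 0⟩, ⟨0, 0⟩, ⟨1, 2⟩],
    !![⟨0, 1⟩, ⟨-1, -1⟩, ⟨-1, -1⟩; ⟨-1, -1⟩, ⟨0, 1⟩, ⟨-1, -1⟩; ⟨-1, -1⟩, ⟨-1, -1⟩, ⟨0, 1⟩],
    !![⟨0, 1⟩, ⟨-1, -1⟩, ⟨-1, -1⟩; ⟨-1, -1⟩, ⟨0, 1⟩, ⟨-1, -1⟩; ⟨1, 0⟩, ⟨1, 0⟩, ⟨-1, -1⟩],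
    !![⟨1, 1⟩, ⟨0, -1⟩, ⟨0, -1⟩; ⟨0, -1⟩, ⟨1, 1⟩, ⟨0, -1⟩; ⟨0, -1⟩, ⟨0, -1⟩, ⟨1, 1⟩],
    !![⟨0, 1⟩, ⟨-1, -1⟩, ⟨-1, -1⟩; ⟨1, 0⟩, ⟨-1, -1⟩, ⟨1, 0⟩; ⟨-1, -1⟩, ⟨-1, -1⟩, ⟨0, 1⟩],
    !![⟨0, 1⟩, ⟨-1, -1⟩, ⟨-1, -1⟩; ⟨-1, -1⟩, ⟨0, 1⟩, ⟨-1, -1⟩; ⟨0, 1⟩, ⟨0, 1⟩, ⟨1, 0⟩],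
    !![⟨0, 1⟩, ⟨-1, -1⟩, ⟨-1, -1⟩; ⟨1, 0⟩, ⟨-1, -1⟩, ⟨1, 0⟩; ⟨1, 0⟩, ⟨1, 0⟩, ⟨-1, -1⟩],
    !![⟨1, 1⟩, ⟨0, -1⟩, ⟨0, -1⟩; ⟨0, -1⟩, ⟨1, 1⟩, ⟨0, -1⟩; ⟨1, 1⟩, ⟨1, 1⟩, ⟨-1, 0⟩],
    !![⟨1, 1⟩, ⟨0, -1⟩, ⟨0, -1⟩; ⟨1, 1⟩, ⟨-1, 0⟩, ⟨1, 1⟩; ⟨0, -1⟩, ⟨0, -1⟩, ⟨1, 1⟩],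
    !![⟨0, 1⟩, ⟨-1, -1⟩, ⟨-1, -1⟩; ⟨0, 1⟩, ⟨1, 0⟩, ⟨0, 1⟩; ⟨-1, -1⟩, ⟨-1, -1⟩, ⟨0, 1⟩],
    !![⟨0, 0⟩, ⟨-1, -2⟩, ⟨0, 0⟩; ⟨-1, -2⟩, ⟨0, 0⟩, ⟨0, 0⟩; ⟨0, 0⟩, ⟨0, 0⟩, ⟨2, 1⟩],
    !![⟨0, 1⟩, ⟨-1, -1⟩, ⟨-1, -1⟩; ⟨1, 0⟩, ⟨-1, -1⟩, ⟨1, 0⟩; ⟨0, 1⟩, ⟨0, 1⟩, ⟨1, 0⟩],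
    !![⟨-1, 1⟩, ⟨0, 0⟩, ⟨0, 0⟩; ⟨0, 0⟩, ⟨0, 0⟩, ⟨2, 1⟩; ⟨0, 0⟩, ⟨2, 1⟩, ⟨0, 0⟩],
    !![⟨0, 1⟩, ⟨-1, -1⟩, ⟨-1, -1⟩; ⟨0, 1⟩, ⟨1, 0⟩, ⟨0, 1⟩; ⟨1, 0⟩, ⟨1, 0⟩, ⟨-1, -1⟩],
    !![⟨1, 1⟩, ⟨0, -1⟩, ⟨0, -1⟩; ⟨0, -1⟩, ⟨1, 1⟩, ⟨0, -1⟩; ⟨-1, 0⟩, ⟨-1, 0⟩, ⟨0, -1⟩],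
    !![⟨1, 1⟩, ⟨0, -1⟩, ⟨0, -1⟩; ⟨1, 1⟩, ⟨-1, 0⟩, ⟨1, 1⟩; ⟨1, 1⟩, ⟨1, 1⟩, ⟨-1, 0⟩],
    !![⟨1, 1⟩, ⟨0, -1⟩, ⟨0, -1⟩; ⟨-1, 0⟩, ⟨0, -1⟩, ⟨-1, 0⟩; ⟨0, -1⟩, ⟨0, -1⟩, ⟨1, 1⟩],
    !![⟨0, 0⟩, ⟨0, 0⟩, ⟨-1, -2⟩; ⟨0, 0⟩, ⟨2, 1⟩, ⟨0, 0⟩; ⟨-1, -2⟩, ⟨0, 0⟩, ⟨0, 0⟩],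
    !![⟨-1, 0⟩, ⟨0, -1⟩, ⟨-1, 0⟩; ⟨0, -1⟩, ⟨0, -1⟩, ⟨1, 1⟩; ⟨-1, 0⟩, ⟨1, 1⟩, ⟨1, 1⟩],
    !![⟨0, 1⟩, ⟨-1, -1⟩, ⟨-1, -1⟩; ⟨0, 1⟩, ⟨1, 0⟩, ⟨0, 1⟩; ⟨0, 1⟩, ⟨0, 1⟩, ⟨1, 0⟩],
    !![⟨-1, 0⟩, ⟨-1, 0⟩, ⟨-1, 0⟩; ⟨0, -1⟩, ⟨-1, 0⟩, ⟨1, 1⟩; ⟨0, -1⟩, ⟨1, 1⟩, ⟨-1, 0⟩],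
    !![⟨-1, 0⟩, ⟨-1, 0⟩, ⟨0, -1⟩; ⟨-1, 0⟩, ⟨1, 1⟩, ⟨1, 1⟩; ⟨0, -1⟩, ⟨1, 1⟩, ⟨0, -1⟩],
    !![⟨0, 0⟩, ⟨0, 0⟩, ⟨-2, -1⟩; ⟨1, -1⟩, ⟨0, 0⟩, ⟨0, 0⟩; ⟨0, 0⟩, ⟨1, 2⟩, ⟨0, 0⟩],
    !![⟨0, 0⟩, ⟨-2, -1⟩, ⟨0, 0⟩; ⟨0, 0⟩, ⟨0, 0⟩, ⟨1, 2⟩; ⟨1, -1⟩, ⟨0, 0⟩, ⟨0, 0⟩]]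

/-- action of the generators on the cosets -/
def stp : Fin 3 → Fin 24 → Fin 24 :=
  ![![0, 2, 5, 7, 6, 1, 11, 14, 15, 13, 10, 4, 12, 19, 3, 21, 18, 17, 20, 9, 16, 8, 22, 23],
    ![1, 3, 2, 0, 4, 10, 12, 5, 9, 17, 7, 18, 20, 21, 14, 15, 16, 8, 22, 19, 6, 23, 11, 13],
    ![0, 4, 6, 8, 9, 11, 13, 15, 16, 1, 10, 19, 12, 2, 21, 18, 3, 17, 7, 5, 14, 20, 22, 23]]

/-- the diagonal cocycle of the action -/
def coc : Fin 3 → Fin 24 → Fin 3 → Fin 3 :=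
  ![![![0, 0, 1], ![0, 0, 0], ![0, 0, 0], ![0, 0, 0], ![0, 0, 0], ![0, 0, 0], ![0, 0, 0], ![0, 0, 0], ![0, 0, 0], ![0, 0, 0], ![0, 0, 1], ![0, 0, 0], ![0, 1, 0], ![0, 0, 0], ![0, 0, 0], ![2, 1, 0], ![2, 0, 1], ![1, 0, 0], ![0, 1, 0], ![0, 0, 0], ![1, 2, 2], ![1, 2, 0], ![0, 1, 0], ![1, 0, 0]],
    ![![0, 0, 0], ![0, 0, 0], ![0, 0, 1], ![0, 0, 0], ![0, 1, 0], ![0, 0, 0], ![0, 0, 0], ![0, 0, 1], ![0, 1, 0], ![0, 0, 0], ![0, 0, 2], ![0, 0, 0], ![0, 0, 0], ![0, 0, 0], ![0, 0, 1], ![1, 0, 0], ![0, 1, 0], ![0, 2, 0], ![0, 0, 0], ![1, 0, 0], ![0, 0, 0], ![0, 0, 0], ![0, 0, 0], ![0, 0, 0]],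
    ![![0, 1, 0], ![0, 0, 0], ![0, 0, 0], ![0, 0, 0], ![0, 0, 0], ![0, 0, 0], ![0, 0, 0], ![0, 0, 0], ![0, 0, 0], ![0, 0, 0], ![1, 0, 0], ![0, 0, 0], ![0, 0, 1], ![0, 0, 0], ![2, 1, 0], ![2, 0, 1], ![0, 0, 0], ![0, 1, 0], ![1, 0, 2], ![0, 0, 0], ![1, 2, 2], ![0, 0, 1], ![1, 0, 0], ![0, 0, 1]]]

/-- spanning tree: the generator -/
def parG : Fin 24 → Fin 3 := ![0, 1, 0, 1, 2, 0, 2, 0, 2, 2, 1, 2, 1, 2, 0, 2, 2, 1, 1, 2, 1, 1, 1, 1]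

/-- spanning tree: the parent -/
def parI : Fin 24 → Fin 24 := ![0, 0, 1, 1, 1, 2, 2, 3, 3, 4, 5, 5, 6, 6, 7, 7, 8, 9, 11, 11, 12, 13, 18, 21]

lemma step_eq : ∀ g i, gn g * rp i = th • (rp (stp g i) * dg (coc g i)) := by decide +kernel

lemma par_lt : ∀ i, i ≠ 0 → parI i < i := by decide +kernel

lemma par_step : ∀ i, i ≠ 0 → stp (parG i) (parI i) = i ∧ coc (parG i) (parI i) = 0 := by
  decide +kernel

lemma pw_add : ∀ x y, pw (x + y) = pw x * pw y := by decide +kernel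

lemma dg_add (x y : Fin 3 → Fin 3) : dg (x + y) = dg x * dg y := by
  simp [dg, diagonal_mul_diagonal, pw_add]

lemma rp_zero : rp 0 = th • 1 := by decide +kernel

lemma dg_zero : dg 0 = 1 := by decide +kernel

lemma rp_inj : ∀ i j, i ≠ j → ∃ k, ∀ p : Fin 3, ∃ l, rp i l k ≠ rp j l k * pw p := by
  decide +kernel

lemma rp_col : ∀ i k, ∃ l, rp i l k ≠ 0 := by decide +kernel

lemma rp_diag (i : Fin 24) (h : i ≠ 0) : ∃ k l : Fin 3, k ≠ l ∧ rp i k l ≠ 0 := by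
  have key : ∀ i : Fin 24, i = 0 ∨ ∃ q : Fin 3 × Fin 3, (if q.1 = q.2 then 0 else rp i q.1 q.2) ≠ 0 := by
    decide +kernel
  obtain ⟨q, hq⟩ := (key i).resolve_left h
  refine ⟨q.1, q.2, ?_, ?_⟩
  · intro hh; simp [hh] at hq
  · intro hh; simp [hh] at hq

lemma pw_inj : ∀ x y, pw x = pw y → x = y := by decide +kernel

lemma pw_unit : ∀ x, pw x * pw (-x) = 1 := by decide +kernel

lemma gn_cube : ∀ g, gn g * gn g * gn g = (th * th * th) • 1 := by decide +kernel

lemma om_val : ω = -(1 / 2 : ℂ) + (Real.sqrt 3 / 2 : ℝ) * Complex.I := by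
  have h : (2 * Real.pi * Complex.I / 3 : ℂ) = ((Real.pi - Real.pi / 3 : ℝ) : ℂ) * Complex.I := by
    push_cast; ring
  rw [ω, h, Complex.exp_mul_I, ← Complex.ofReal_cos, ← Complex.ofReal_sin, Real.cos_pi_sub,
    Real.sin_pi_sub, Real.cos_pi_div_three, Real.sin_pi_div_three]
  push_cast; ring

lemma om_sq : ω * ω = -1 - ω := by
  have h3 : ((Real.sqrt 3 : ℝ) : ℂ) * (Real.sqrt 3 : ℝ) = 3 := by
    rw [← Complex.ofReal_mul, Real.mul_self_sqrt (by norm_num)]; norm_num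
  rw [om_val]
  push_cast
  linear_combination (1 / 4 * Complex.I * Complex.I) * h3 + 3 / 4 * Complex.I_mul_I

/-- evaluation of Eisenstein integers in ℂ -/
def ev : Eis →+* ℂ :=
  (QuadraticAlgebra.lift (R := ℤ) (a := -1) (b := -1)
    ⟨ω, by rw [om_sq]; simp; ring⟩ : Eis →ₐ[ℤ] ℂ).toRingHom

lemma ev_mk (x y : ℤ) : ev ⟨x, y⟩ = x + y * ω := by
  simp [ev, QuadraticAlgebra.lift]

lemma ev_inj : Function.Injective ev := by
  rw [injective_iff_map_eq_zero]
  rintro ⟨x, y⟩ h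
  rw [ev_mk, om_val] at h
  have h1 := congrArg Complex.im h
  have h2 := congrArg Complex.re h
  simp at h1 h2
  subst h1
  simp at h2
  subst h2
  rfl

lemma th_ne : ev th ≠ 0 := by
  rw [map_ne_zero_iff _ ev_inj]; decide +kernel

/-- the matrix `g` is represented by the coset `i` and the diagonal `d` -/
def HRep (g : Matrix (Fin 3) (Fin 3) ℂ) (i : Fin 24) (d : Fin 3 → Fin 3) : Prop :=
  ev th • g = (rp i * dg d).map ev

lemma map_smul_ev (t : Eis) (A : Matrix (Fin 3) (Fin 3) Eis) :
    (t • A).map ev = ev t • A.map ev := by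
  ext i j; simp

lemma smul_cancel {A B : Matrix (Fin 3) (Fin 3) ℂ} (h : ev th • A = ev th • B) : A = B :=
  smul_right_injective _ th_ne h

lemma rep_step {x g : Matrix (Fin 3) (Fin 3) ℂ} {k i d} (hx : ev th • x = (gn k).map ev)
    (h : HRep g i d) : HRep (x * g) (stp k i) (coc k i + d) := by
  unfold HRep at *
  apply smul_cancel
  have e : th • (rp (stp k i) * dg (coc k i + d)) = gn k * (rp i * dg d) := by
    rw [dg_add, ← Matrix.mul_assoc, ← Matrix.mul_assoc, step_eq, Matrix.smul_mul]
  rw [← map_smul_ev, e, Matrix.map_mul, ← h, ← hx, Matrix.smul_mul, Matrix.mul_smul]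

lemma rep_mul {g h : Matrix (Fin 3) (Fin 3) ℂ} {i d e} (hg : HRep g i d) (hh : HRep h 0 e) :
    HRep (g * h) i (d + e) := by
  have hh' : h = (dg e).map ev := by
    apply smul_cancel
    rw [hh, rp_zero, Matrix.smul_mul, Matrix.one_mul, map_smul_ev]
  unfold HRep at *
  rw [dg_add, ← Matrix.mul_assoc, Matrix.map_mul, ← hg, hh', Matrix.smul_mul]

lemma rep_one : HRep 1 0 0 := by
  unfold HRep
  rw [rp_zero, dg_zero, Matrix.mul_one, map_smul_ev]
  simp

lemma rep_unique {g : Matrix (Fin 3) (Fin 3) ℂ} {i j d e} (h : HRep g i d) (h' : HRep g j e) :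
    i = j ∧ d = e := by
  have h0 : rp i * dg d = rp j * dg e :=
    Matrix.map_injective ev_inj (h.symm.trans h')
  have h1 : ∀ l k, rp i l k * pw (d k) = rp j l k * pw (e k) := by
    intro l k
    have := congrFun (congrFun h0 l) k
    simpa [dg, mul_diagonal] using this
  have h2 : ∀ l k, rp i l k = rp j l k * pw (e k + - d k) := by
    intro l k
    rw [pw_add, ← mul_assoc, ← h1, mul_assoc, pw_unit, mul_one]
  have hij : i = j := by
    by_contra hne
    obtain ⟨k, hk⟩ := rp_inj i j hne
    obtain ⟨l, hl⟩ := hk (e k + - d k)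
    exact hl (h2 l k)
  refine ⟨hij, ?_⟩
  subst hij
  funext k
  obtain ⟨l, hl⟩ := rp_col i k
  have h3 := congrArg ev (h1 l k)
  rw [map_mul, map_mul] at h3
  have h4 : ev (rp i l k) ≠ 0 := by rwa [map_ne_zero_iff _ ev_inj]
  exact pw_inj _ _ (ev_inj (mul_left_cancel₀ h4 h3))

lemma gen_a : ev th • m1 = (gn 0).map ev := by
  ext i j
  fin_cases i <;> fin_cases j <;> simp [m1, gn, th, ev_mk]
  linear_combination 2 * om_sq

lemma gen_c : ev th • m3 = (gn 2).map ev := by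
  ext i j
  fin_cases i <;> fin_cases j <;> simp [m3, gn, th, ev_mk]
  linear_combination 2 * om_sq

lemma m2_val : m2 = Matrix.of fun i j => if i = j then (ω + 2) / 3 else (ω - 1) / 3 := by
  ext i j
  simp only [m2, Matrix.of_apply, om_val]
  split_ifs <;> push_cast <;> ring

lemma gen_b : ev th • m2 = (gn 1).map ev := by
  rw [m2_val]
  ext i j
  fin_cases i <;> fin_cases j <;> simp [gn, th, ev_mk] <;> linear_combination 2 / 3 * om_sq

lemma cube_one {x : GL (Fin 3) ℂ} {k} (hx : ev th • (x : Matrix (Fin 3) (Fin 3) ℂ) = (gn k).map ev) :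
    x⁻¹ = x * x := by
  rw [inv_eq_iff_mul_eq_one]
  ext1
  have h := congrArg (fun M => M.map ev) (gn_cube k)
  simp only [Matrix.map_mul, map_smul_ev, ← hx] at h
  simp only [Units.val_mul, Units.val_one]
  apply smul_cancel
  apply smul_cancel
  apply smul_cancel
  rw [← mul_assoc]
  simpa [smul_smul, mul_assoc] using h

section
variable (x : Fin 3 → GL (Fin 3) ℂ)

lemma exists_rep (hx : ∀ k, ev th • (x k : Matrix (Fin 3) (Fin 3) ℂ) = (gn k).map ev)
    {g} (hg : g ∈ Subgroup.closure (Set.range x)) :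
    ∃ p : Fin 24 × (Fin 3 → Fin 3), HRep (g : Matrix (Fin 3) (Fin 3) ℂ) p.1 p.2 := by
  induction hg using Subgroup.closure_induction_left with
  | one => exact ⟨(0, 0), by simpa using rep_one⟩
  | mul_left y hy z hz ih =>
    obtain ⟨k, rfl⟩ := hy
    obtain ⟨⟨i, d⟩, h⟩ := ih
    refine ⟨(stp k i, coc k i + d), ?_⟩
    rw [Units.val_mul]
    exact rep_step (hx k) h
  | inv_mul_cancel y hy z hz ih =>
    obtain ⟨k, rfl⟩ := hy
    obtain ⟨⟨i, d⟩, h⟩ := ih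
    rw [cube_one (hx k), mul_assoc, Units.val_mul, Units.val_mul]
    exact ⟨⟨_, _⟩, rep_step (hx k) (rep_step (hx k) h)⟩

lemma exists_coset (hx : ∀ k, ev th • (x k : Matrix (Fin 3) (Fin 3) ℂ) = (gn k).map ev)
    (i : Fin 24) :
    ∃ g ∈ Subgroup.closure (Set.range x), HRep (g : Matrix (Fin 3) (Fin 3) ℂ) i 0 := by
  induction i using WellFoundedLT.induction with
  | ind i ih =>
    by_cases h0 : i = 0
    · subst h0
      exact ⟨1, one_mem _, by simpa using rep_one⟩
    · obtain ⟨g, hg, h⟩ := ih _ (par_lt i h0)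
      refine ⟨x (parG i) * g, mul_mem (Subgroup.subset_closure ⟨_, rfl⟩) hg, ?_⟩
      have := rep_step (hx (parG i)) h
      rw [(par_step i h0).1, (par_step i h0).2] at this
      simpa using this

/-- run a word on the coset tables -/
def run : List (Fin 3) → Fin 24 × (Fin 3 → Fin 3)
  | [] => (0, 0)
  | k :: w => (stp k (run w).1, coc k (run w).1 + (run w).2)

lemma exists_run (hx : ∀ k, ev th • (x k : Matrix (Fin 3) (Fin 3) ℂ) = (gn k).map ev)
    (w : List (Fin 3)) :
    ∃ g ∈ Subgroup.closure (Set.range x),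
      HRep (g : Matrix (Fin 3) (Fin 3) ℂ) (run w).1 (run w).2 := by
  induction w with
  | nil => exact ⟨1, one_mem _, by simpa [run] using rep_one⟩
  | cons k w ih =>
    obtain ⟨g, hg, h⟩ := ih
    exact ⟨x k * g, mul_mem (Subgroup.subset_closure ⟨_, rfl⟩) hg, by
      simpa [run] using rep_step (hx k) h⟩

lemma run_basis : ∀ k : Fin 3, run (![[1, 0, 0, 1, 2, 1, 0, 0, 1, 0], [2], [0]] k)
    = (0, Pi.single k 1) := by decide +kernel

lemma exists_diag (hx : ∀ k, ev th • (x k : Matrix (Fin 3) (Fin 3) ℂ) = (gn k).map ev)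
    (d : Fin 3 → Fin 3) :
    ∃ g ∈ Subgroup.closure (Set.range x), HRep (g : Matrix (Fin 3) (Fin 3) ℂ) 0 d := by
  have hs : ∀ k (n : ℕ), ∃ g ∈ Subgroup.closure (Set.range x),
      HRep (g : Matrix (Fin 3) (Fin 3) ℂ) 0 (n • Pi.single k 1) := by
    intro k n
    induction n with
    | zero => exact ⟨1, one_mem _, by simpa using rep_one⟩
    | succ n ih =>
      obtain ⟨g, hg, h⟩ := ih
      obtain ⟨g', hg', h'⟩ := exists_run x hx (![[1, 0, 0, 1, 2, 1, 0, 0, 1, 0], [2], [0]] k)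
      rw [run_basis] at h'
      refine ⟨g * g', mul_mem hg hg', ?_⟩
      rw [Units.val_mul, succ_nsmul]
      exact rep_mul h h'
  obtain ⟨g0, hg0, h0⟩ := hs 0 (d 0)
  obtain ⟨g1, hg1, h1⟩ := hs 1 (d 1)
  obtain ⟨g2, hg2, h2⟩ := hs 2 (d 2)
  refine ⟨g0 * g1 * g2, mul_mem (mul_mem hg0 hg1) hg2, ?_⟩
  have h3 := rep_mul (rep_mul h0 h1) h2
  have hd : ∀ d : Fin 3 → Fin 3, ((d 0 : Fin 3) : ℕ) • (Pi.single 0 1 : Fin 3 → Fin 3)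
      + ((d 1 : Fin 3) : ℕ) • (Pi.single 1 1 : Fin 3 → Fin 3)
      + ((d 2 : Fin 3) : ℕ) • (Pi.single 2 1 : Fin 3 → Fin 3) = d := by decide +kernel
  rw [hd] at h3
  simpa using h3

lemma card_closure (hx : ∀ k, ev th • (x k : Matrix (Fin 3) (Fin 3) ℂ) = (gn k).map ev) :
    Nat.card (Subgroup.closure (Set.range x)) = 648 := by
  choose f hf using fun g : Subgroup.closure (Set.range x) => exists_rep x hx g.2
  have hbij : Function.Bijective f := by
    constructor
    · intro g g' h
      ext1; ext1
      apply smul_cancel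
      have h1 := hf g
      have h2 := hf g'
      rw [← h] at h2
      exact h1.trans h2.symm
    · rintro ⟨i, d⟩
      obtain ⟨g, hg, h⟩ := exists_coset x hx i
      obtain ⟨g', hg', h'⟩ := exists_diag x hx d
      refine ⟨⟨g * g', mul_mem hg hg'⟩, ?_⟩
      have h3 := rep_mul h h'
      rw [zero_add] at h3
      have h4 := hf ⟨g * g', mul_mem hg hg'⟩
      rw [Units.val_mul] at h4
      exact Prod.ext (rep_unique h4 h3).1 (rep_unique h4 h3).2
  rw [Nat.card_eq_of_bijective f hbij]
  simp

end

lemma rep_scalar (k : Fin 3) : HRep (ev (pw k) • 1) 0 (fun _ => k) := by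
  unfold HRep
  rw [rp_zero, Matrix.smul_mul, Matrix.one_mul, map_smul_ev]
  congr 1
  ext i j
  by_cases h : i = j
  · subst h; simp [dg]
  · simp [dg, h]

lemma ev_pw (k : Fin 3) : ev (pw k) = ω ^ (k : ℕ) := by
  fin_cases k <;> simp [pw, ev_mk]
  linear_combination -om_sq

lemma om_ne_one : ω ≠ 1 := by
  intro h
  have := om_sq
  rw [h] at this
  norm_num at this

lemma comm_scalar {g : Matrix (Fin 3) (Fin 3) ℂ} (h1 : g * m1 = m1 * g) (h2 : g * m2 = m2 * g)
    (h3 : g * m3 = m3 * g) : g = g 0 0 • 1 := by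
  have hw : ω - 1 ≠ 0 := sub_ne_zero.2 om_ne_one
  have e1 : ∀ i j, (g * m1) i j = (m1 * g) i j := fun i j => by rw [h1]
  have e3 : ∀ i j, (g * m3) i j = (m3 * g) i j := fun i j => by rw [h3]
  have e2 : ∀ i j, (g * m2) i j = (m2 * g) i j := fun i j => by rw [h2]
  simp only [m1, m3, mul_diagonal, diagonal_mul] at e1 e3
  have z02 : g 0 2 = 0 := by
    have := e1 0 2
    simp at this
    exact (mul_eq_zero.1 (show g 0 2 * (ω - 1) = 0 by linear_combination this)).resolve_right hw
  have z12 : g 1 2 = 0 := by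
    have := e1 1 2
    simp at this
    exact (mul_eq_zero.1 (show g 1 2 * (ω - 1) = 0 by linear_combination this)).resolve_right hw
  have z20 : g 2 0 = 0 := by
    have := e1 2 0
    simp at this
    exact (mul_eq_zero.1 (show g 2 0 * (ω - 1) = 0 by linear_combination -this)).resolve_right hw
  have z21 : g 2 1 = 0 := by
    have := e1 2 1
    simp at this
    exact (mul_eq_zero.1 (show g 2 1 * (ω - 1) = 0 by linear_combination -this)).resolve_right hw
  have z01 : g 0 1 = 0 := by
    have := e3 0 1
    simp at this
    exact (mul_eq_zero.1 (show g 0 1 * (ω - 1) = 0 by linear_combination this)).resolve_right hw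
  have z10 : g 1 0 = 0 := by
    have := e3 1 0
    simp at this
    exact (mul_eq_zero.1 (show g 1 0 * (ω - 1) = 0 by linear_combination -this)).resolve_right hw
  have d1 : g 1 1 = g 0 0 := by
    have := e2 0 1
    rw [m2_val] at this
    simp [Matrix.mul_apply, Fin.sum_univ_three, z01, z02, z21] at this
    have h : (g 1 1 - g 0 0) * (ω - 1) = 0 := by linear_combination -3 * this
    exact sub_eq_zero.1 ((mul_eq_zero.1 h).resolve_right hw)
  have d2 : g 2 2 = g 0 0 := by
    have := e2 0 2
    rw [m2_val] at this
    simp [Matrix.mul_apply, Fin.sum_univ_three, z01, z02, z12] at this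
    have h : (g 2 2 - g 0 0) * (ω - 1) = 0 := by linear_combination -3 * this
    exact sub_eq_zero.1 ((mul_eq_zero.1 h).resolve_right hw)
  ext i j
  fin_cases i <;> fin_cases j <;> simp [z01, z02, z10, z12, z20, z21, d1, d2]

lemma scalar_rep {g : Matrix (Fin 3) (Fin 3) ℂ} {i d} (hs : g = g 0 0 • 1) (h : HRep g i d) :
    ∃ k, g = ev (pw k) • 1 := by
  have hi : i = 0 := by
    by_contra hne
    obtain ⟨k, l, hkl, hz⟩ := rp_diag i hne
    apply hz
    have h1 := congrFun (congrFun h k) l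
    rw [hs] at h1
    simp [hkl, dg, mul_diagonal] at h1
    rcases h1 with h1 | h1
    · exact (map_eq_zero_iff ev ev_inj).1 h1
    · exfalso
      have h2 := pw_unit (d l)
      have h3 := congrArg ev h2
      rw [map_mul, h1] at h3
      simp at h3
  subst hi
  refine ⟨d 0, ?_⟩
  have h1 := congrFun (congrFun h 0) 0
  rw [rp_zero] at h1
  simp [dg, mul_diagonal] at h1
  rw [hs, h1.resolve_right th_ne]

/-- The group generated by the three braiding gates of the W-model has order 648,
its center consists exactly of the scalar matrices I, ωI, ω²I, and the quotient
by the center has order 216 (the Hessian group Σ(216)). -/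
theorem stmt2 (a b c : GL (Fin 3) ℂ)
    (ha : (a : Matrix (Fin 3) (Fin 3) ℂ) = m1)
    (hb : (b : Matrix (Fin 3) (Fin 3) ℂ) = m2)
    (hc : (c : Matrix (Fin 3) (Fin 3) ℂ) = m3) :
    Nat.card (Subgroup.closure ({a, b, c} : Set (GL (Fin 3) ℂ))) = 648 ∧
    (∀ g : GL (Fin 3) ℂ,
      (g ∈ Subgroup.closure ({a, b, c} : Set (GL (Fin 3) ℂ)) ∧
        ∀ h ∈ Subgroup.closure ({a, b, c} : Set (GL (Fin 3) ℂ)), g * h = h * g) ↔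
      ((g : Matrix (Fin 3) (Fin 3) ℂ) = 1 ∨
       (g : Matrix (Fin 3) (Fin 3) ℂ) = ω • (1 : Matrix (Fin 3) (Fin 3) ℂ) ∨
       (g : Matrix (Fin 3) (Fin 3) ℂ) = ω ^ 2 • (1 : Matrix (Fin 3) (Fin 3) ℂ))) ∧
    Nat.card
      ((Subgroup.closure ({a, b, c} : Set (GL (Fin 3) ℂ))) ⧸
        Subgroup.center (Subgroup.closure ({a, b, c} : Set (GL (Fin 3) ℂ)))) = 216 := by
  
  set x : Fin 3 → GL (Fin 3) ℂ := ![a, b, c] with hxdef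
  have hr : ({a, b, c} : Set (GL (Fin 3) ℂ)) = Set.range x := by
    ext y
    simp [hxdef, eq_comm]
    tauto
  have hx : ∀ k, ev th • (x k : Matrix (Fin 3) (Fin 3) ℂ) = (gn k).map ev := by
    intro k
    fin_cases k
    · simpa [hxdef, ha] using gen_a
    · simpa [hxdef, hb] using gen_b
    · simpa [hxdef, hc] using gen_c
  rw [hr]
  have hcard := card_closure x hx
  have hmem : ∀ k, x k ∈ Subgroup.closure (Set.range x) :=
    fun k => Subgroup.subset_closure ⟨k, rfl⟩
  -- the central elements
  have hcen : ∀ g : GL (Fin 3) ℂ, (g ∈ Subgroup.closure (Set.range x) ∧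
      ∀ h ∈ Subgroup.closure (Set.range x), g * h = h * g) ↔
      ∃ k, (g : Matrix (Fin 3) (Fin 3) ℂ) = ev (pw k) • 1 := by
    intro g
    constructor
    · rintro ⟨hg, hcomm⟩
      obtain ⟨p, hp⟩ := exists_rep x hx hg
      refine scalar_rep (comm_scalar ?_ ?_ ?_) hp
      · rw [← ha]; exact congrArg Units.val (hcomm _ (hmem 0))
      · rw [← hb]; exact congrArg Units.val (hcomm _ (hmem 1))
      · rw [← hc]; exact congrArg Units.val (hcomm _ (hmem 2))
    · rintro ⟨k, hk⟩
      constructor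
      · obtain ⟨g', hg', h'⟩ := exists_diag x hx (fun _ => k)
        have : g = g' := by
          ext1
          apply smul_cancel
          rw [hk]
          exact (rep_scalar k).trans h'.symm
        rwa [this]
      · intro h _
        ext1
        simp [hk]
  refine ⟨hcard, ?_, ?_⟩
  · intro g
    rw [hcen g]
    simp [Fin.exists_fin_succ, ev_pw]
  · have hex : ∀ k : Fin 3, ∃ z : Subgroup.center (Subgroup.closure (Set.range x)),
        ((z : Subgroup.closure (Set.range x)) : GL (Fin 3) ℂ).val = ev (pw k) • 1 := by
      intro k
      obtain ⟨g', hg', h'⟩ := exists_diag x hx (fun _ => k)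
      have hk : (g' : Matrix (Fin 3) (Fin 3) ℂ) = ev (pw k) • 1 :=
        smul_cancel (h'.trans (rep_scalar k).symm)
      refine ⟨⟨⟨g', hg'⟩, ?_⟩, hk⟩
      rw [Subgroup.mem_center_iff]
      rintro ⟨h, hh⟩
      exact Subtype.ext (((hcen g').2 ⟨k, hk⟩).2 h hh).symm
    choose f hf using hex
    have hbij : Function.Bijective f := by
      constructor
      · intro k l hkl
        have h1 := hf k
        rw [hkl, hf l] at h1
        have h2 := congrFun (congrFun h1 0) 0
        simp at h2
        exact (pw_inj _ _ (ev_inj h2)).symm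
      · rintro ⟨⟨g, hg⟩, hz⟩
        rw [Subgroup.mem_center_iff] at hz
        obtain ⟨k, hk⟩ := (hcen g).1 ⟨hg, fun h hh =>
          (congrArg Subtype.val (hz ⟨h, hh⟩)).symm⟩
        refine ⟨k, ?_⟩
        ext1; ext1; ext1
        exact (hf k).trans hk.symm
    have h3 := Nat.card_eq_of_bijective f hbij
    have h4 := Subgroup.card_eq_card_quotient_mul_card_subgroup
      (Subgroup.center (Subgroup.closure (Set.range x)))
    rw [hcard, ← h3] at h4
    simp at h4
    omega
end
end

section
/- Let σ₁ = diag(1, 1, 1, ω², 1, ω², ω, 1, ω), σ₃ = diag(1, 1, 1, 1, ω², ω, ω², ω, 1), and σ₂ = (1/3)·M, where M is the 9×9 matrix with rows (1,1,1,ω²,ω²,1,1,ω,ω), (1,1,1,ω,1,ω,ω²,1,ω²), (1,1,1,1,ω,ω²,ω,ω²,1), (ω²,ω,1,1,ω²,ω,1,1,1), (ω²,1,ω,ω²,1,1,ω,1,1), (1,ω,ω²,ω,1,1,1,ω²,1), (1,ω²,ω,1,ω,1,1,1,ω²), (ω,1,ω²,1,1,ω²,1,1,ω), (ω,ω²,1,1,1,1,ω²,ω,1).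 Then the subgroup of GL(9,ℂ) generated by σ₁, σ₂, σ₃ is a finite group of order 216. -/
open Matrix Complex

noncomputable section

/-- The image of the braid generator σ₁ on V_F^{DDDD}. -/
def s1 : Matrix (Fin 9) (Fin 9) ℂ :=
  diagonal ![1, 1, 1, ω ^ 2, 1, ω ^ 2, ω, 1, ω]

/-- The image of the braid generator σ₃ on V_F^{DDDD}. -/
def s3 : Matrix (Fin 9) (Fin 9) ℂ :=
  diagonal ![1, 1, 1, 1, ω ^ 2, ω, ω ^ 2, ω, 1]

/-- The image of the braid generator σ₂ on V_F^{DDDD}. -/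
def s2 : Matrix (Fin 9) (Fin 9) ℂ := (1 / 3 : ℂ) •
  !![1, 1, 1, ω ^ 2, ω ^ 2, 1, 1, ω, ω;
     1, 1, 1, ω, 1, ω, ω ^ 2, 1, ω ^ 2;
     1, 1, 1, 1, ω, ω ^ 2, ω, ω ^ 2, 1;
     ω ^ 2, ω, 1, 1, ω ^ 2, ω, 1, 1, 1;
     ω ^ 2, 1, ω, ω ^ 2, 1, 1, ω, 1, 1;
     1, ω, ω ^ 2, ω, 1, 1, 1, ω ^ 2, 1;
     1, ω ^ 2, ω, 1, ω, 1, 1, 1, ω ^ 2;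
     ω, 1, ω ^ 2, 1, 1, ω ^ 2, 1, 1, ω;
     ω, ω ^ 2, 1, 1, 1, 1, ω ^ 2, ω, 1]


set_option linter.unusedSimpArgs false

abbrev Pt := ZMod 3 × ZMod 3

/-- Horizontal line supporting a basis vector. -/
def Rr : Fin 9 → ZMod 3 := ![2, 0, 1, 1, 0, 2, 2, 0, 1]

/-- Frequency of a basis vector along its line. -/
def Kr : Fin 9 → ZMod 3 := ![0, 0, 0, 1, 2, 2, 1, 1, 2]

/-- Character of `ZMod 3`. -/
def w : ZMod 3 → ℂ := ![1, ω, ω ^ 2]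

/-- The intertwiner. -/
def T : Matrix (Fin 9) Pt ℂ := fun r p => if p.2 = Rr r then w (Kr r * p.1) else 0

/-- The inverse of the intertwiner. -/
def Tinv : Matrix Pt (Fin 9) ℂ := fun p r => if p.2 = Rr r then w (2 * (Kr r * p.1)) / 3 else 0

/-- Permutation matrices. -/
def P (g : Equiv.Perm Pt) : Matrix Pt Pt ℂ := fun i j => if i = g j then 1 else 0

/-- Affine maps of determinant one. -/
def aff (a b c d e f : ZMod 3) (h : a * d - b * c = 1) : Equiv.Perm Pt where
  toFun p := (a * p.1 + b * p.2 + e, c * p.1 + d * p.2 + f)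
  invFun p := (d * (p.1 - e) - b * (p.2 - f), -c * (p.1 - e) + a * (p.2 - f))
  left_inv p := by
    ext
    · linear_combination p.1 * h
    · linear_combination p.2 * h
  right_inv p := by
    ext
    · linear_combination (p.1 - e) * h
    · linear_combination (p.2 - f) * h

def p1 : Equiv.Perm Pt := aff 1 2 0 1 0 0 (by decide)
def p2 : Equiv.Perm Pt := aff 1 0 1 1 0 0 (by decide)
def p3 : Equiv.Perm Pt := aff 1 2 0 1 1 0 (by decide)

lemma omega_rel : ω ^ 2 + ω + 1 = 0 := by
  have h : IsPrimitiveRoot ω 3 := by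
    have := Complex.isPrimitiveRoot_exp 3 (by norm_num)
    simpa [ω] using this
  have := h.geom_sum_eq_zero (by norm_num)
  simp [Finset.sum_range_succ] at this
  linear_combination this

lemma P_mul (g h : Equiv.Perm Pt) : P (g * h) = P g * P h := by
  ext i j
  simp [P, Matrix.mul_apply]
  congr

lemma P_one : P 1 = 1 := by
  ext i j
  simp [P, Matrix.one_apply]
  congr

lemma P_inj : Function.Injective P := by
  intro g h e
  ext1 j
  have := congrFun (congrFun e (g j)) j
  by_contra hne
  simp [P, hne] at this

lemma mul_P (g : Equiv.Perm Pt) (r : Fin 9) (p : Pt) : (T * P g) r p = T r (g p) := by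
  simp [P, Matrix.mul_apply]

lemma sum_pt (F : Pt → ℂ) : ∑ p, F p = ((F (0,0) + F (0,1) + F (0,2)) + (F (1,0) + F (1,1) + F (1,2))
    + (F (2,0) + F (2,1) + F (2,2))) := by
  rw [Fintype.sum_prod_type]
  have h (f : ZMod 3 → ℂ) : ∑ x, f x = f 0 + f 1 + f 2 := Fin.sum_univ_three f
  simp only [h]

lemma w0 : w 0 = 1 := rfl
lemma w1 : w 1 = ω := rfl
lemma w2 : w 2 = ω ^ 2 := rfl

lemma forall_z {Q : ZMod 3 → Prop} (h0 : Q 0) (h1 : Q 1) (h2 : Q 2) (x : ZMod 3) : Q x := by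
  fin_cases x
  exacts [h0, h1, h2]

lemma z1 : ¬ (0 : ZMod 3) = 1 := by decide
lemma z2 : ¬ (0 : ZMod 3) = 2 := by decide
lemma z3 : ¬ (1 : ZMod 3) = 0 := by decide
lemma z4 : ¬ (1 : ZMod 3) = 2 := by decide
lemma z5 : ¬ (2 : ZMod 3) = 0 := by decide
lemma z6 : ¬ (2 : ZMod 3) = 1 := by decide
lemma y1 : (2 : ZMod 3) * 2 = 1 := by decide
lemma y2 : (2 : ZMod 3) + 1 = 0 := by decide
lemma y3 : (2 : ZMod 3) + 2 = 1 := by decide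
lemma y4 : (1 : ZMod 3) + 2 = 0 := by decide
lemma y5 : (1 : ZMod 3) + 1 = 2 := by decide

lemma T_mul_Tinv : T * Tinv = 1 := by
  have h := omega_rel
  ext i j
  rw [Matrix.mul_apply, sum_pt]
  fin_cases i <;> fin_cases j <;>
    simp [T, Tinv, Rr, Kr, z1, z2, z3, z4, z5, z6, y1, y2, y3, y4, y5, w0, w1, w2, Matrix.one_apply] <;> grind

lemma Tinv_mul_T : Tinv * T = 1 := (Matrix.mul_eq_one_comm_of_card_eq _ _ _ (by simp [ZMod.card])).1 T_mul_Tinv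

lemma s1_T : s1 * T = T * P p1 := by
  have h := omega_rel
  ext i ⟨x, y⟩
  rw [mul_P, s1, Matrix.diagonal_mul]
  revert x y
  refine forall_z (forall_z ?_ ?_ ?_) (forall_z ?_ ?_ ?_) (forall_z ?_ ?_ ?_) <;> fin_cases i <;>
    simp [T, p1, aff, Rr, Kr, z1, z2, z3, z4, z5, z6, y1, y2, y3, y4, y5, w0, w1, w2] <;> grind

lemma s3_T : s3 * T = T * P p3 := by
  have h := omega_rel
  ext i ⟨x, y⟩
  rw [mul_P, s3, Matrix.diagonal_mul]
  revert x y
  refine forall_z (forall_z ?_ ?_ ?_) (forall_z ?_ ?_ ?_) (forall_z ?_ ?_ ?_) <;> fin_cases i <;>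
    simp [T, p3, aff, Rr, Kr, z1, z2, z3, z4, z5, z6, y1, y2, y3, y4, y5, w0, w1, w2] <;> grind

lemma s2_T : s2 * T = T * P p2 := by
  have h := omega_rel
  ext i ⟨x, y⟩
  rw [mul_P, s2, Matrix.smul_mul, Matrix.smul_apply, Matrix.mul_apply]
  revert x y
  refine forall_z (forall_z ?_ ?_ ?_) (forall_z ?_ ?_ ?_) (forall_z ?_ ?_ ?_) <;> fin_cases i <;>
    simp [Fin.sum_univ_succ, T, p2, aff, Rr, Kr, z1, z2, z3, z4, z5, z6, y1, y2, y3, y4, y5, w0, w1, w2] <;> grind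

/-- Translation. -/
def tr (e f : ZMod 3) : Equiv.Perm Pt := aff 1 0 0 1 e f (by decide)
/-- Upper transvection. -/
def up (i : ZMod 3) : Equiv.Perm Pt := aff 1 i 0 1 0 0 (by ring)
/-- Lower transvection. -/
def lo (i : ZMod 3) : Equiv.Perm Pt := aff 1 0 i 1 0 0 (by ring)

/-- The affine group of determinant one. -/
def H : Subgroup (Equiv.Perm Pt) where
  carrier := {g | ∃ a b c d e f h, g = aff a b c d e f h}
  one_mem' := ⟨1, 0, 0, 1, 0, 0, by ring, by ext p <;> simp [aff]⟩
  mul_mem' := by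
    rintro _ _ ⟨a, b, c, d, e, f, h, rfl⟩ ⟨a', b', c', d', e', f', h', rfl⟩
    refine ⟨a * a' + b * c', a * b' + b * d', c * a' + d * c', c * b' + d * d',
      a * e' + b * f' + e, c * e' + d * f' + f,
      by linear_combination (a' * d' - b' * c') * h + h', ?_⟩
    ext p <;> simp [aff] <;> ring
  inv_mem' := by
    rintro _ ⟨a, b, c, d, e, f, h, rfl⟩
    refine ⟨d, -b, -c, a, -d * e + b * f, c * e - a * f, by linear_combination h, ?_⟩
    rw [inv_eq_iff_mul_eq_one]
    ext p
    · simp [aff]; linear_combination (p.1 - e) * h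
    · simp [aff]; linear_combination (p.2 - f) * h

/-- Parameters of affine maps. -/
abbrev Par := {t : ZMod 3 × ZMod 3 × ZMod 3 × ZMod 3 × ZMod 3 × ZMod 3 //
  t.1 * t.2.2.2.1 - t.2.1 * t.2.2.1 = 1}

lemma card_par : Fintype.card Par = 216 := by decide +kernel

lemma card_H : Nat.card H = 216 := by
  rw [← card_par, ← Nat.card_eq_fintype_card]
  symm
  refine Nat.card_congr (Equiv.ofBijective (fun t : Par => (⟨aff t.1.1 t.1.2.1 t.1.2.2.1 t.1.2.2.2.1 t.1.2.2.2.2.1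
    t.1.2.2.2.2.2 t.2, _, _, _, _, _, _, _, rfl⟩ : H)) ⟨?_, ?_⟩)
  · rintro ⟨⟨a, b, c, d, e, f⟩, h⟩ ⟨⟨a', b', c', d', e', f'⟩, h'⟩ hh
    have hh := congrArg Subtype.val hh
    have h0 := congrArg (fun g : Equiv.Perm Pt => g (0, 0)) hh
    have h1 := congrArg (fun g : Equiv.Perm Pt => g (1, 0)) hh
    have h2 := congrArg (fun g : Equiv.Perm Pt => g (0, 1)) hh
    simp [aff] at h0 h1 h2
    obtain ⟨rfl, rfl⟩ := h0
    simp at h1 h2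
    obtain ⟨rfl, rfl⟩ := h1
    obtain ⟨rfl, rfl⟩ := h2
    rfl
  · rintro ⟨_, a, b, c, d, e, f, h, rfl⟩
    exact ⟨⟨(a, b, c, d, e, f), h⟩, rfl⟩

lemma factor : ∀ a b c d : ZMod 3, a * d - b * c = 1 → ∃ i j k l : ZMod 3,
    (1 + i * j) * (1 + k * l) + i * l = a ∧ (1 + i * j) * k + i = b ∧
      j * (1 + k * l) + l = c ∧ j * k + 1 = d := by decide +kernel

lemma closure_eq : Subgroup.closure {p1, p2, p3} = H := by
  set C := Subgroup.closure {p1, p2, p3} with hC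
  have m1 : p1 ∈ C := Subgroup.subset_closure (by simp)
  have m2 : p2 ∈ C := Subgroup.subset_closure (by simp)
  have m3 : p3 ∈ C := Subgroup.subset_closure (by simp)
  apply le_antisymm
  · rw [hC, Subgroup.closure_le]
    rintro _ (rfl | rfl | rfl)
    exacts [⟨_, _, _, _, _, _, _, rfl⟩, ⟨_, _, _, _, _, _, _, rfl⟩, ⟨_, _, _, _, _, _, _, rfl⟩]
  have hu : ∀ i, up i ∈ C := by
    have : ∀ i, up i = p1 ^ (2 * i).val := by decide +kernel
    intro i
    rw [this]
    exact pow_mem m1 _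
  have hl : ∀ i, lo i ∈ C := by
    have : ∀ i, lo i = p2 ^ i.val := by decide +kernel
    intro i
    rw [this]
    exact pow_mem m2 _
  have ht : ∀ e f, tr e f ∈ C := by
    have : ∀ e f, tr e f = (p3 * p1⁻¹) ^ (e - f).val * (p2 * (p3 * p1⁻¹) * p2⁻¹) ^ f.val := by
      decide +kernel
    intro e f
    rw [this]
    have m4 := mul_mem m3 (inv_mem m1)
    exact mul_mem (pow_mem m4 _) (pow_mem (mul_mem (mul_mem m2 m4) (inv_mem m2)) _)
  rintro _ ⟨a, b, c, d, e, f, h, rfl⟩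
  obtain ⟨i, j, k, l, rfl, rfl, rfl, rfl⟩ := factor a b c d h
  have : aff _ _ _ _ e f h = tr e f * (up i * lo j * up k * lo l) := by
    ext p <;> simp [aff, tr, up, lo] <;> ring
  rw [this]
  exact mul_mem (ht e f) (mul_mem (mul_mem (mul_mem (hu i) (hl j)) (hu k)) (hl l))

/-- The representation on permutations. -/
def phi0 : Equiv.Perm Pt →* Matrix (Fin 9) (Fin 9) ℂ where
  toFun g := T * P g * Tinv
  map_one' := by rw [P_one, Matrix.mul_one, T_mul_Tinv]
  map_mul' g h := by
    rw [P_mul]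
    calc T * (P g * P h) * Tinv = T * P g * (1 : Matrix Pt Pt ℂ) * P h * Tinv := by simp only [Matrix.mul_one, Matrix.mul_assoc]
      _ = _ := by rw [← Tinv_mul_T]; simp only [Matrix.mul_assoc]

lemma phi0_inj : Function.Injective phi0 := by
  intro g h e
  apply P_inj
  have key (g) : Tinv * phi0 g * T = P g := by
    calc Tinv * (T * P g * Tinv) * T = (Tinv * T) * P g * (Tinv * T) := by simp only [Matrix.mul_assoc]
      _ = _ := by rw [Tinv_mul_T, Matrix.one_mul, Matrix.mul_one]
  rw [← key g, ← key h, e]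

lemma phi0_eq {s : Matrix (Fin 9) (Fin 9) ℂ} {g} (h : s * T = T * P g) : phi0 g = s := by
  change T * P g * Tinv = s
  rw [← h, Matrix.mul_assoc, T_mul_Tinv, Matrix.mul_one]

/-- The subgroup of GL(9,ℂ) generated by σ₁, σ₂, σ₃ is a finite group of
order 216 (the Hessian group Σ(216)). -/
theorem stmt13 (a b c : GL (Fin 9) ℂ)
    (ha : (a : Matrix (Fin 9) (Fin 9) ℂ) = s1)
    (hb : (b : Matrix (Fin 9) (Fin 9) ℂ) = s2)
    (hc : (c : Matrix (Fin 9) (Fin 9) ℂ) = s3) :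
    Nat.card (Subgroup.closure ({a, b, c} : Set (GL (Fin 9) ℂ))) = 216 := by
  let φ : Equiv.Perm Pt →* GL (Fin 9) ℂ := phi0.toHomUnits
  have hφ : Function.Injective φ := fun g h e => phi0_inj (congrArg Units.val e)
  have h1 : φ p1 = a := Units.ext ((phi0_eq s1_T).trans ha.symm)
  have h2 : φ p2 = b := Units.ext ((phi0_eq s2_T).trans hb.symm)
  have h3 : φ p3 = c := Units.ext ((phi0_eq s3_T).trans hc.symm)
  have : Subgroup.closure ({a, b, c} : Set (GL (Fin 9) ℂ)) = H.map φ := by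
    rw [← closure_eq, MonoidHom.map_closure, Set.image_insert_eq, Set.image_pair, h1, h2, h3]
  rw [this, ← card_H]
  exact (Nat.card_congr (H.equivMapOfInjective φ hφ).toEquiv).symm
end
end
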